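/- Let m ≥ 1 and d ≥ 1 be integers, and for 0 ≤ i ≤ ⌊(d−1)/2⌋ let b_i be the number of standard Young tableaux of shape (m+1, 2^i, 1^{d−2i−1}), the partition with first part m+1, then i parts equal to 2 and d−2i−1 parts equal to 1 (these b_i are the coefficients of the inverse Kazhdan–Lusztig polynomial of the uniform matroid U_{m,d}). Then the sequence (b_i) is log-concave: b_i² ≥ b_{i−1} · b_{i+1} for all 1 ≤ i ≤ ⌊(d−1)/2⌋ − 1. -/

import Mathlib

/-- The cells of the skew Young diagram `λ/μ` (0-indexed): the cell `(r, c)` belongs to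
the diagram iff `r < length λ` and `μ_r ≤ c < λ_r`, padding `μ` with zeros. -/
def skewCells (l m : List ℕ) : Finset (ℕ × ℕ) :=
  (Finset.range l.length ×ˢ Finset.range (l.foldr max 0)).filter
    (fun p => m.getD p.1 0 ≤ p.2 ∧ p.2 < l.getD p.1 0)

/-- The number of standard Young tableaux of skew shape `λ/μ` : bijective fillings of the
cells by `1, …, n` (here realized as `Fin n`) strictly increasing along each row and
down each column. -/
noncomputable def sytCount (l m : List ℕ) : ℕ :=
  Nat.card {T : {p // p ∈ skewCells l m} → Fin (skewCells l m).card //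
    Function.Bijective T ∧
    (∀ p q : {p // p ∈ skewCells l m}, p.1.1 = q.1.1 → p.1.2 < q.1.2 → T p < T q) ∧
    (∀ p q : {p // p ∈ skewCells l m}, p.1.2 = q.1.2 → p.1.1 < q.1.1 → T p < T q)}

/-- The fillings of `S` by `0, …, |S| - 1`, extended by zero, that are strictly increasing along
the relation `r`. -/
def fillings {α : Type*} (r : α → α → Prop) (S : Finset α) : Set (α → ℕ) :=
  {T | (∀ x, x ∉ S → T x = 0) ∧ Set.BijOn T S (Set.Iio S.card) ∧
    ∀ p ∈ S, ∀ q ∈ S, r p q → T p < T q}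

instance finite_fillings {α : Type*} (r : α → α → Prop) (S : Finset α) :
    Finite (fillings r S) := by
  refine Finite.of_injective
    (fun T (x : S) => (⟨T.1 x, T.2.2.1.mapsTo x.2⟩ : Fin S.card)) ?_
  rintro ⟨T, hT⟩ ⟨T', hT'⟩ h
  ext x
  by_cases hx : x ∈ S
  · simpa using congrArg Fin.val (congrFun h ⟨x, hx⟩)
  · simp [hT.1 x hx, hT'.1 x hx]

theorem card_fillings_empty {α : Type*} (r : α → α → Prop) :
    Nat.card (fillings r (∅ : Finset α)) = 1 := by
  rw [Nat.card_eq_one_iff_unique]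
  refine ⟨⟨fun T T' => ?_⟩, ⟨⟨fun _ => 0, by simp [fillings, Set.BijOn, Set.MapsTo, Set.SurjOn]⟩⟩⟩
  ext x
  simp [T.2.1 x, T'.2.1 x]

/-- The number of fillings is obtained by summing over the positions of the largest entry. -/
theorem card_fillings_eq_sum {α : Type*} [DecidableEq α] (r : α → α → Prop)
    (S M : Finset α) (hS : S.Nonempty) (hM : ∀ p, p ∈ M ↔ p ∈ S ∧ ∀ q ∈ S, ¬ r p q) :
    Nat.card (fillings r S) = ∑ p ∈ M, Nat.card (fillings r (S.erase p)) := by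
  rw [← Finset.sum_coe_sort, ← Nat.card_sigma]
  symm
  have hpos := hS.card_pos
  have hmem : ∀ x : Σ p : {p // p ∈ M},
      fillings r (S.erase p), Function.update x.2.1 x.1.1 (S.card - 1) ∈ fillings r S := by
    rintro ⟨⟨p, hp⟩, T, hT0, hTb, hTm⟩
    obtain ⟨hpS, hmax⟩ := (hM p).1 hp
    have hc := Finset.card_erase_of_mem hpS
    rw [hc] at hTb
    have hlt : ∀ x ∈ S, x ≠ p → T x < S.card - 1 := fun x hx hxp =>
      hTb.mapsTo (by simp [hx, hxp])
    refine ⟨?_, ⟨?_, ?_, ?_⟩, ?_⟩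
    · intro x hx
      have : x ≠ p := by rintro rfl; exact hx hpS
      simp [this, hT0 x (by simp [hx])]
    · intro x hx
      by_cases h : x = p
      · subst h; simp; omega
      · have := hlt x hx h
        simp [h]; omega
    · intro x hx y hy hxy
      by_cases h : x = p <;> by_cases h' : y = p
      · rw [h, h']
      · have := hlt y hy h'
        simp [h, h'] at hxy; omega
      · have := hlt x hx h
        simp [h, h'] at hxy; omega
      · simp [h, h'] at hxy
        exact hTb.injOn (by simpa [h] using hx) (by simpa [h'] using hy) hxy
    · intro v hv
      by_cases h : v = S.card - 1
      · exact ⟨p, hpS, by simp [h]⟩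
      · obtain ⟨x, hx, rfl⟩ := hTb.surjOn (show v ∈ Set.Iio (S.card - 1) by
          simp at hv ⊢; omega)
        simp at hx
        exact ⟨x, hx.1, by simp [hx.2]⟩
    · intro x hx y hy hxy
      have h : x ≠ p := by rintro rfl; exact hmax y hy hxy
      by_cases h' : y = p
      · have := hlt x hx h
        simpa [h, h'] using this
      · simpa [h, h'] using hTm x (by simp [h, hx]) y (by simp [h', hy]) hxy
  refine Nat.card_eq_of_bijective (fun x => ⟨_, hmem x⟩) ⟨?_, ?_⟩
  · rintro ⟨⟨p, hp⟩, T, hT⟩ ⟨⟨p', hp'⟩, T', hT'⟩ h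
    have hm' := hmem ⟨⟨p', hp'⟩, T', hT'⟩
    simp only [Subtype.mk.injEq] at h
    simp only at hm'
    obtain rfl : p = p' := by
      refine hm'.2.1.injOn ((hM _).1 hp).1 ((hM _).1 hp').1 ?_
      rw [← h]
      simp [h]
    obtain rfl : T = T' := by
      ext x
      by_cases hx : x = p
      · rw [hx, hT.1 p (by simp), hT'.1 p (by simp)]
      · simpa [hx] using congrFun h x
    rfl
  · rintro ⟨T, hT⟩
    obtain ⟨hT0, hTb, hTm⟩ := id hT
    obtain ⟨p, hpS, hp⟩ := hTb.surjOn (show S.card - 1 ∈ Set.Iio S.card by simp; omega)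
    have hlt : ∀ x ∈ S, T x < S.card := fun x hx => hTb.mapsTo hx
    refine ⟨⟨⟨p, ?_⟩, Function.update T p 0, ?_, ⟨?_, ?_, ?_⟩, ?_⟩, ?_⟩
    · refine (hM p).2 ⟨hpS, fun q hq hpq => ?_⟩
      have := hTm p hpS q hq hpq
      have := hlt q hq
      omega
    · intro x hx
      by_cases h : x = p
      · simp [h]
      · simp [h] at hx ⊢
        exact hT0 x hx
    · intro x hx
      simp only [Finset.mem_coe, Finset.mem_erase] at hx
      have h1 := hlt x hx.2
      have h2 : T x ≠ T p := fun h => hx.1 (hTb.injOn hx.2 hpS h)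
      simp [hx.1, Finset.card_erase_of_mem hpS]
      omega
    · intro x hx y hy hxy
      simp only [Finset.mem_coe, Finset.mem_erase] at hx hy
      simp [hx.1, hy.1] at hxy
      exact hTb.injOn hx.2 hy.2 hxy
    · intro v hv
      simp [Finset.card_erase_of_mem hpS] at hv
      obtain ⟨x, hx, rfl⟩ := hTb.surjOn (show v ∈ Set.Iio S.card by simp; omega)
      have h : x ≠ p := by rintro rfl; omega
      exact ⟨x, by simpa [h] using hx, by simp [h]⟩
    · intro x hx y hy hxy
      simp at hx hy
      simpa [hx.1, hy.1] using hTm x hx.2 y hy.2 hxy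
    · simp [← hp]

/-- Fillings of `S` as functions on the subtype `S` with values in `Fin |S|`. -/
theorem card_subtype_eq_card_fillings {α : Type*} (r : α → α → Prop) (S : Finset α) :
    Nat.card {T : {p // p ∈ S} → Fin S.card //
      Function.Bijective T ∧ ∀ p q : {p // p ∈ S}, r p.1 q.1 → T p < T q} =
    Nat.card (fillings r S) := by
  classical
  symm
  refine Nat.card_eq_of_bijective
    (fun T => ⟨fun x => ⟨T.1 x, T.2.2.1.mapsTo x.2⟩, ⟨?_, ?_⟩, ?_⟩) ⟨?_, ?_⟩
  · intro x y h
    exact Subtype.ext (T.2.2.1.injOn x.2 y.2 (congrArg Fin.val h))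
  · intro v
    obtain ⟨x, hx, h⟩ := T.2.2.1.surjOn (show v.1 ∈ Set.Iio S.card from v.2)
    exact ⟨⟨x, hx⟩, Fin.ext h⟩
  · intro p q h
    exact T.2.2.2 p.1 p.2 q.1 q.2 h
  · rintro ⟨T, hT⟩ ⟨T', hT'⟩ h
    simp only [Subtype.mk.injEq] at h
    ext x
    by_cases hx : x ∈ S
    · simpa using congrArg Fin.val (congrFun h ⟨x, hx⟩)
    · simp [hT.1 x hx, hT'.1 x hx]
  · rintro ⟨T, hTb, hTm⟩
    refine ⟨⟨fun x => if h : x ∈ S then T ⟨x, h⟩ else 0, ?_, ⟨?_, ?_, ?_⟩, ?_⟩, ?_⟩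
    · intro x hx
      simp [hx]
    · intro x hx
      have hx : x ∈ S := hx
      simp [hx]
    · intro x hx y hy h
      have hx : x ∈ S := hx
      have hy : y ∈ S := hy
      simp only [hx, hy, dif_pos] at h
      simpa using hTb.1 (Fin.ext h)
    · intro v hv
      obtain ⟨x, hx⟩ := hTb.2 ⟨v, hv⟩
      exact ⟨x.1, x.2, by simp [hx]⟩
    · intro p hp q hq h
      simpa [hp, hq] using hTm ⟨p, hp⟩ ⟨q, hq⟩ h
    · simp

/-- `q` lies strictly to the right of `p` in its row, or strictly below `p` in its column. -/
def cellLT (p q : ℕ × ℕ) : Prop := (p.1 = q.1 ∧ p.2 < q.2) ∨ (p.2 = q.2 ∧ p.1 < q.1)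

theorem sytCount_eq_card_fillings (l m : List ℕ) :
    sytCount l m = Nat.card (fillings cellLT (skewCells l m)) := by
  rw [← card_subtype_eq_card_fillings, sytCount]
  refine Nat.card_congr (Equiv.subtypeEquivRight fun T => and_congr_right fun _ => ?_)
  constructor
  · rintro ⟨h1, h2⟩ p q (⟨h, h'⟩ | ⟨h, h'⟩)
    exacts [h1 p q h h', h2 p q h h']
  · intro h
    exact ⟨fun p q h1 h2 => h p q (Or.inl ⟨h1, h2⟩), fun p q h1 h2 => h p q (Or.inr ⟨h1, h2⟩)⟩

/-- The Young diagram of `(a, 2^i, 1^k)`. -/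
def hookCells (a i k : ℕ) : Finset (ℕ × ℕ) :=
  skewCells (a :: (List.replicate i 2 ++ List.replicate k 1)) []

theorem mem_hookCells {a i k : ℕ} {p : ℕ × ℕ} :
    p ∈ hookCells a i k ↔ (p.1 = 0 ∧ p.2 < a) ∨ (1 ≤ p.1 ∧ p.1 ≤ i ∧ p.2 < 2) ∨
      (i < p.1 ∧ p.1 ≤ i + k ∧ p.2 = 0) := by
  obtain ⟨r, c⟩ := p
  have hle : ∀ (l : List ℕ) (r c : ℕ), c < l.getD r 0 → r < l.length ∧ c < l.foldr max 0 := by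
    intro l
    induction l with
    | nil => simp
    | cons x l ih =>
      intro r c h
      cases r with
      | zero => simp at h ⊢; omega
      | succ r =>
        have := ih r c (by simpa using h)
        simp; omega
  have : (r, c) ∈ hookCells a i k ↔
      c < (a :: (List.replicate i 2 ++ List.replicate k 1)).getD r 0 := by
    have := hle (a :: (List.replicate i 2 ++ List.replicate k 1)) r c
    simp only [hookCells, skewCells, Finset.mem_filter, Finset.mem_product, Finset.mem_range]
    constructor
    · exact fun h => h.2.2
    · exact fun h => ⟨this h, by simp, h⟩
  rw [this]
  cases r with
  | zero => simp
  | succ r =>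
    simp only [List.getD_cons_succ]
    by_cases h1 : r < i
    · rw [List.getD_append _ _ _ _ (by simpa using h1)]
      simp [List.getD_eq_getElem?_getD, h1]
    · rw [List.getD_append_right _ _ _ _ (by simpa using h1)]
      by_cases h2 : r - i < k
      · simp [List.getD_eq_getElem?_getD, h2]; omega
      · simp [List.getD_eq_getElem?_getD, h2]; omega

/-- The number of standard Young tableaux of shape `(a, 2^i, 1^k)`. -/
noncomputable def hookCount (a i k : ℕ) : ℕ := Nat.card (fillings cellLT (hookCells a i k))

theorem hookCount_one (k : ℕ) : hookCount 1 0 k = 1 := by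
  classical
  have key : ∀ k, hookCount 1 0 k =
      Nat.card (fillings cellLT ((hookCells 1 0 k).erase (k, 0))) := by
    intro k
    rw [hookCount, card_fillings_eq_sum _ _ {(k, 0)} ⟨(0, 0), by simp [mem_hookCells]⟩,
      Finset.sum_singleton]
    rintro ⟨r, c⟩
    simp only [Finset.mem_singleton, mem_hookCells, cellLT, Prod.forall, Prod.mk.injEq]
    constructor
    · rintro ⟨rfl, rfl⟩
      exact ⟨by omega, by intros; omega⟩
    · rintro ⟨h1, h2⟩
      have := h2 k 0
      omega
  induction k with
  | zero =>
    rw [key, show (hookCells 1 0 0).erase (0, 0) = ∅ from ?_, card_fillings_empty]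
    ext ⟨r, c⟩
    simp [mem_hookCells]; omega
  | succ k ih =>
    rw [key, show (hookCells 1 0 (k + 1)).erase (k + 1, 0) = hookCells 1 0 k from ?_]
    · exact ih
    ext ⟨r, c⟩
    simp [mem_hookCells]; omega

/-- The branching rule for the shapes `(a, 2^i, 1^k)`. -/
theorem hookCount_branching (b i k : ℕ) :
    hookCount (b + 2) i k = (if 1 ≤ b ∨ i = 0 then hookCount (b + 1) i k else 0) +
      (if 1 ≤ i then hookCount (b + 2) (i - 1) (k + 1) else 0) +
      (if 1 ≤ k then hookCount (b + 2) i (k - 1) else 0) := by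
  classical
  rw [hookCount, card_fillings_eq_sum _ _
    ((({(0, b + 1)} : Finset (ℕ × ℕ)).filter (fun _ => 1 ≤ b ∨ i = 0) ∪
        ({(i, 1)} : Finset (ℕ × ℕ)).filter (fun _ => 1 ≤ i)) ∪
        ({(i + k, 0)} : Finset (ℕ × ℕ)).filter (fun _ => 1 ≤ k))
    ⟨(0, 0), by simp [mem_hookCells]⟩, Finset.sum_union, Finset.sum_union]
  · simp only [Finset.sum_filter, Finset.sum_singleton]
    congr 1
    · congr 1
      · refine if_congr Iff.rfl ?_ rfl
        rw [hookCount]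
        congr 3
        ext ⟨r, c⟩
        simp [mem_hookCells]; omega
      · split_ifs with h
        · rw [hookCount]
          congr 3
          ext ⟨r, c⟩
          simp [mem_hookCells]; omega
        · rfl
    · split_ifs with h
      · rw [hookCount]
        congr 3
        ext ⟨r, c⟩
        simp [mem_hookCells]; omega
      · rfl
  · rw [Finset.disjoint_left]
    rintro ⟨r, c⟩
    simp only [Finset.mem_filter, Finset.mem_singleton, Prod.mk.injEq]
    omega
  · rw [Finset.disjoint_left]
    rintro ⟨r, c⟩
    simp only [Finset.mem_union, Finset.mem_filter, Finset.mem_singleton, Prod.mk.injEq]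
    omega
  · rintro ⟨r, c⟩
    simp only [Finset.mem_filter, Finset.mem_union, Finset.mem_singleton, mem_hookCells, cellLT,
      Prod.forall, Prod.mk.injEq]
    constructor
    · intro h
      exact ⟨by omega, by intros; omega⟩
    · rintro ⟨h1, h2⟩
      have := h2 r (c + 1)
      have := h2 (r + 1) c
      omega

open Nat in
/-- The hook length formula for the shapes `(b + 2, 2^i, 1^k)`. -/
theorem hookCount_eq (b i k : ℕ) :
    (hookCount (b + 2) i k : ℚ) = (b + 2 + 2 * i + k)! * (k + 1) /
      ((b + 2 + i + k) * (b + 1 + i) * b ! * (k + i + 1)! * i !) := by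
  induction hn : b + 2 * i + k using Nat.strong_induction_on generalizing b i k with
  | _ n ih =>
  subst hn
  have h₁ : ((if 1 ≤ b ∨ i = 0 then hookCount (b + 1) i k else 0 : ℕ) : ℚ) =
      (b + 1 + 2 * i + k)! * (k + 1) * (if i = 0 then 1 else b / (b + i) : ℚ) /
        ((b + 1 + i + k) * b ! * (k + i + 1)! * i !) := by
    rcases b with _ | b
    · rcases i with _ | i
      · simp [hookCount_one]
        rw [show 1 + k = k + 1 by ring]
        field_simp
        ring
      · simp
    · rw [if_pos (by simp), ih (b + 2 * i + k) (by omega) b i k rfl]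
      have : (if i = 0 then (1 : ℚ) else ((b + 1 : ℕ) : ℚ) / ((b + 1 : ℕ) + i)) =
          (b + 1) / (b + 1 + i) := by
        split_ifs with h
        · subst h; field_simp; simp
        · push_cast; rfl
      rw [this, show b + 1 + 1 + 2 * i + k = b + 2 + 2 * i + k by ring, Nat.factorial_succ b]
      push_cast
      field_simp
      ring
  have h₂ : ((if 1 ≤ i then hookCount (b + 2) (i - 1) (k + 1) else 0 : ℕ) : ℚ) =
      (b + 1 + 2 * i + k)! * (k + 2) * (if i = 0 then 0 else i / (b + i) : ℚ) /
        ((b + 2 + i + k) * b ! * (k + i + 1)! * i !) := by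
    rcases i with _ | i
    · simp
    · rw [if_pos (by simp), add_tsub_cancel_right,
        ih (b + 2 * i + (k + 1)) (by omega) b i (k + 1) rfl, if_neg (by simp),
        show b + 1 + 2 * (i + 1) + k = b + 2 + 2 * i + (k + 1) by ring,
        show k + (i + 1) + 1 = k + 1 + i + 1 by ring, Nat.factorial_succ i]
      push_cast
      field_simp
      ring
  have h₃ : ((if 1 ≤ k then hookCount (b + 2) i (k - 1) else 0 : ℕ) : ℚ) =
      (b + 1 + 2 * i + k)! * k * (k + i + 1) /
        ((b + 1 + i + k) * (b + 1 + i) * b ! * (k + i + 1)! * i !) := by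
    rcases k with _ | k
    · simp
    · rw [if_pos (by simp), add_tsub_cancel_right, ih (b + 2 * i + k) (by omega) b i k rfl,
        show b + 1 + 2 * i + (k + 1) = b + 2 + 2 * i + k by ring,
        show k + 1 + i + 1 = (k + i + 1) + 1 by ring, Nat.factorial_succ (k + i + 1)]
      push_cast
      field_simp
      ring
  rw [hookCount_branching, Nat.cast_add, Nat.cast_add, h₁, h₂, h₃,
    show b + 2 + 2 * i + k = (b + 1 + 2 * i + k) + 1 by ring,
    Nat.factorial_succ (b + 1 + 2 * i + k)]
  split_ifs with h
  · subst h
    push_cast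
    field_simp
    ring
  · have : (b : ℚ) + i ≠ 0 := by positivity
    push_cast
    field_simp
    ring

open Nat in
/-- The hook lengths in terms of `m` and `d`, as in the inverse Kazhdan–Lusztig polynomial. -/
theorem hookCount_eq_of_le (m i j : ℕ) (hij : i < j) :
    (hookCount (m + 2) i (j - i - 1) : ℚ) = (m + 1 + (i + j))! * (j - i) /
      ((m ! : ℚ) * (((m + 1 + i) * i !) * ((m + 1 + j) * j !))) := by
  obtain ⟨k, rfl⟩ := Nat.exists_eq_add_of_lt hij
  rw [show i + k + 1 - i - 1 = k by omega, hookCount_eq,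
    show m + 1 + (i + (i + k + 1)) = m + 2 + 2 * i + k by ring,
    show k + i + 1 = i + k + 1 by ring]
  push_cast
  congr 1 <;> ring

open Nat in
/-- Log-convexity of `x ↦ (m + 1 + x) x!`. -/
theorem add_mul_factorial_log_convex (m x : ℕ) :
    ((m + 1 + (x + 1 : ℕ)) * (x + 1)! : ℚ) ^ 2 ≤
      ((m + 1 + x) * x !) * ((m + 1 + (x + 2 : ℕ)) * (x + 2)!) := by
  rw [Nat.factorial_succ (x + 1), Nat.factorial_succ x]
  push_cast
  have : (0 : ℚ) ≤ (x ! : ℚ) ^ 2 * (x + 1) * (((m : ℚ) + 1 + x) * (m + 3 + x) * (x + 2)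
      - (m + 2 + x) ^ 2 * (x + 1)) := by
    have : (0 : ℚ) ≤ ((m : ℚ) + 1 + x) * (m + 3 + x) * (x + 2) - (m + 2 + x) ^ 2 * (x + 1) := by
      ring_nf
      positivity
    positivity
  linarith

/-- Log-concavity of the coefficients of the inverse Kazhdan–Lusztig polynomial of the
uniform matroid U_{m,d} : the numbers of standard Young tableaux of the shapes
(m+1, 2^i, 1^{d−2i−1}) form a log-concave sequence. -/
theorem inverse_KL_coefficients_log_concave (m d : ℕ) (hm : 1 ≤ m) (hd : 1 ≤ d)
    (b : ℕ → ℕ)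
    (hb : ∀ i, i ≤ (d - 1) / 2 →
      b i = sytCount ((m + 1) :: (List.replicate i 2 ++ List.replicate (d - 2 * i - 1) 1)) [])
    (i : ℕ) (h1 : 1 ≤ i) (h2 : i ≤ (d - 1) / 2 - 1) :
    b (i - 1) * b (i + 1) ≤ b i * b i := by
  have hbi : ∀ i, i ≤ (d - 1) / 2 → b i = hookCount (m + 1) i (d - i - i - 1) := by
    intro i hi
    rw [hb i hi, sytCount_eq_card_fillings, hookCount, hookCells,
      show d - 2 * i - 1 = d - i - i - 1 by omega]
  obtain ⟨m, rfl⟩ : ∃ n, m = n + 1 := ⟨m - 1, by omega⟩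
  obtain ⟨x, rfl⟩ : ∃ x, i = x + 1 := ⟨i - 1, by omega⟩
  obtain ⟨y, rfl⟩ : ∃ y, d = x + y + 2 := ⟨d - x - 2, by omega⟩
  have hxy : x + 3 ≤ y + 1 := by omega
  have e₀ := hookCount_eq_of_le m x (y + 2) (by omega)
  have e₁ := hookCount_eq_of_le m (x + 1) (y + 1) (by omega)
  have e₂ := hookCount_eq_of_le m (x + 2) y (by omega)
  have hX := add_mul_factorial_log_convex m x
  have hY := add_mul_factorial_log_convex m y
  rw [add_tsub_cancel_right, hbi x (by omega), hbi (x + 1) (by omega),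
    hbi (x + 1 + 1) (by omega), show x + y + 2 - x = y + 2 by omega,
    show x + y + 2 - (x + 1) = y + 1 by omega, show x + y + 2 - (x + 1 + 1) = y by omega]
  rw [show x + (y + 2) = x + y + 2 by ring] at e₀
  rw [show x + 1 + (y + 1) = x + y + 2 by ring] at e₁
  rw [show x + 2 + y = x + y + 2 by ring] at e₂
  rw [← Nat.cast_le (α := ℚ), Nat.cast_mul, Nat.cast_mul, e₀, e₁, e₂, div_mul_div_comm,
    div_mul_div_comm]
  refine div_le_div₀ (mul_self_nonneg _) ?_ (by positivity) ?_
  · push_cast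
    nlinarith [sq_nonneg (((m + 1 + (x + y + 2)).factorial : ℕ) : ℚ)]
  · have := mul_le_mul hX hY (by positivity) (by positivity)
    have := mul_le_mul_of_nonneg_left this (sq_nonneg (m.factorial : ℚ))
    linarith
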